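/- For the commutative Hopf algebroid H = A ⊗ A over a commutative algebra A (with s(a) = 1⊗a, t(a) = a⊗1, Δ(a⊗b) = (a⊗1)⊗_A(1⊗b), ε(a⊗b) = ab, S(a⊗b) = b⊗a), the map sending [φ, e] ∈ (M(A)⋉E(A))^op to the biretraction α_{[φ,e]}(a⊗b) = φ(ae)·b is an isomorphism of regular monoids onto Brt(A⊗A, A); in particular α_{[φ,e]} ∗ α_{[ψ,f]} = α_{[ψ,f][φ,e]}, the identity class maps to ε, and α_{[φ,e]}* = α_{[φ,e]*}. -/

import Mathlib

open TensorProduct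

/-- The unital ideal `A·e` generated by an element `e` of a commutative ring. -/
def idealOf {A : Type*} [CommRing A] (e : A) : Set A := Set.range (fun a => a * e)

/-- `φ : A → A` is multiplicative. -/
def Mult {A : Type*} [CommRing A] (φ : A → A) : Prop := ∀ x y : A, φ (x * y) = φ x * φ y

variable (k A : Type*) [CommRing k] [CommRing A] [Algebra k A]

/-- The target map `t(a) = a ⊗ 1` of the Hopf algebroid `A ⊗ A`. -/
noncomputable def tMap : A →ₐ[k] A ⊗[k] A := Algebra.TensorProduct.includeLeft

/-- The source map `s(a) = 1 ⊗ a` of the Hopf algebroid `A ⊗ A`. -/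
noncomputable def sMap : A →ₐ[k] A ⊗[k] A := Algebra.TensorProduct.includeRight

/-- The comultiplication `Δ(a⊗b) = (a⊗1) ⊗ (1⊗b)` of the Hopf algebroid `A ⊗ A`. -/
noncomputable def ΔMap : A ⊗[k] A →ₐ[k] (A ⊗[k] A) ⊗[k] (A ⊗[k] A) :=
  Algebra.TensorProduct.map Algebra.TensorProduct.includeLeft
    Algebra.TensorProduct.includeRight

/-- The counit `ε(a⊗b) = ab` of the Hopf algebroid `A ⊗ A`. -/
noncomputable def εMap : A ⊗[k] A →ₐ[k] A := Algebra.TensorProduct.lmul' k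

/-- The antipode `S(a⊗b) = b⊗a` of the Hopf algebroid `A ⊗ A`. -/
noncomputable def SMap : A ⊗[k] A →ₐ[k] A ⊗[k] A := (Algebra.TensorProduct.comm k A A).toAlgHom

/-- The convolution product of linear maps `A ⊗ A → A`:
`(α ∗ β)(h) = β(t(α(h₍₁₎)) · h₍₂₎)`. -/
noncomputable def conv (α β : A ⊗[k] A →ₗ[k] A) : A ⊗[k] A →ₗ[k] A :=
  β ∘ₗ (LinearMap.mul' k (A ⊗[k] A)) ∘ₗ
    (TensorProduct.map ((tMap k A).toLinearMap ∘ₗ α) LinearMap.id) ∘ₗ (ΔMap k A).toLinearMap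

/-- Local biretractions of the Hopf algebroid `A ⊗ A` over `A`. -/
def IsBrt (α : A ⊗[k] A →ₗ[k] A) : Prop :=
  (∀ x y : A ⊗[k] A, α (x * y) = α x * α y) ∧
  (∀ a : A, α (sMap k A a) = a * α 1) ∧
  ∃ e : A, α (tMap k A e) = α 1 ∧
    Set.BijOn (fun a => α (tMap k A a)) (idealOf e) (idealOf (α 1))

/-- The biretraction `α_{[φ,e]}(a ⊗ b) = φ(a·e)·b` of `A ⊗ A` associated to a class
`[φ, e] ∈ M(A) ⋉ E(A)`. -/
noncomputable def brtOf (φ : A →ₗ[k] A) (e : A) : A ⊗[k] A →ₗ[k] A :=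
  TensorProduct.lift ((LinearMap.mul k A) ∘ₗ (φ ∘ₗ LinearMap.mulRight k e))

theorem mul_eq_self_of_mem_idealOf {A : Type*} [CommRing A] {e x : A} (he : e * e = e)
    (hx : x ∈ idealOf e) : x * e = x := by
  obtain ⟨a, rfl⟩ := hx
  simp only [mul_assoc, he]

theorem mul_mem_idealOf {A : Type*} [CommRing A] (a e : A) : a * e ∈ idealOf e := ⟨a, rfl⟩

theorem self_mem_idealOf {A : Type*} [CommRing A] (e : A) : e ∈ idealOf e := ⟨1, one_mul e⟩

variable {k A}

theorem brtOf_tmul (φ : A →ₗ[k] A) (e a b : A) : brtOf k A φ e (a ⊗ₜ b) = φ (a * e) * b := by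
  simp [brtOf]

theorem brtOf_tMap (φ : A →ₗ[k] A) (e a : A) : brtOf k A φ e (tMap k A a) = φ (a * e) := by
  simp [tMap, brtOf_tmul]

theorem brtOf_sMap (φ : A →ₗ[k] A) (e a : A) : brtOf k A φ e (sMap k A a) = φ e * a := by
  simp [sMap, brtOf_tmul]

theorem brtOf_one (φ : A →ₗ[k] A) (e : A) : brtOf k A φ e 1 = φ e := by
  simp [Algebra.TensorProduct.one_def, brtOf_tmul]

theorem brtOf_mul {φ : A →ₗ[k] A} {e : A} (hφ : Mult φ) (he : e * e = e) (x y : A ⊗[k] A) :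
    brtOf k A φ e (x * y) = brtOf k A φ e x * brtOf k A φ e y := by
  induction x with
  | zero => simp
  | add x₁ x₂ h₁ h₂ => rw [add_mul, map_add, h₁, h₂, map_add, add_mul]
  | tmul a b =>
    induction y with
    | zero => simp
    | add y₁ y₂ h₁ h₂ => rw [mul_add, map_add, h₁, h₂, map_add, mul_add]
    | tmul c d =>
      have h : a * c * e = a * e * (c * e) := by linear_combination (-a * c) * he
      rw [Algebra.TensorProduct.tmul_mul_tmul, brtOf_tmul, brtOf_tmul, brtOf_tmul, h, hφ]
      ring

theorem bijOn_brtOf_tMap {φ : A →ₗ[k] A} {e : A} (he : e * e = e)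
    (hb : Set.BijOn φ (idealOf e) (idealOf (φ e))) :
    Set.BijOn (fun a => brtOf k A φ e (tMap k A a)) (idealOf e)
      (idealOf (brtOf k A φ e 1)) := by
  rw [brtOf_one]
  refine hb.congr fun x hx => ?_
  simp only [brtOf_tMap, mul_eq_self_of_mem_idealOf he hx]

theorem isBrt_brtOf {φ : A →ₗ[k] A} {e : A} (hφ : Mult φ) (he : e * e = e)
    (hb : Set.BijOn φ (idealOf e) (idealOf (φ e))) : IsBrt k A (brtOf k A φ e) :=
  ⟨brtOf_mul hφ he, fun a => by rw [brtOf_sMap, brtOf_one, mul_comm],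
    e, by rw [brtOf_tMap, brtOf_one, he], bijOn_brtOf_tMap he hb⟩

theorem conv_tmul (α β : A ⊗[k] A →ₗ[k] A) (a b : A) :
    conv k A α β (a ⊗ₜ b) = β (α (a ⊗ₜ 1) ⊗ₜ b) := by
  simp [conv, ΔMap, tMap]

theorem conv_brtOf {φ : A →ₗ[k] A} (ψ : A →ₗ[k] A) {e f g : A} (hφ : Mult φ)
    (hφg : φ g = f * φ e) :
    conv k A (brtOf k A φ e) (brtOf k A ψ f) = brtOf k A (ψ ∘ₗ φ) g := by
  refine TensorProduct.ext' fun a b => ?_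
  have hag : φ (a * g) = φ (a * e) * f := by
    rw [hφ, hφ, hφg]
    ring
  rw [conv_tmul, brtOf_tmul, brtOf_tmul, brtOf_tmul, mul_one, LinearMap.comp_apply, hag]

theorem brtOf_id_one : brtOf k A LinearMap.id 1 = (εMap k A).toLinearMap := by
  refine TensorProduct.ext' fun a b => ?_
  simp [brtOf_tmul, εMap]

theorem brtOf_comp_SMap_eq {φ ψ inv : A →ₗ[k] A} {e : A} (hφ : Mult φ) (he : e * e = e)
    (hb : Set.BijOn φ (idealOf e) (idealOf (φ e)))
    (hψφ : ∀ x ∈ idealOf e, ψ (φ x) = x)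
    (hinv : ∀ x ∈ idealOf e, inv (brtOf k A φ e (tMap k A x)) = x) :
    inv ∘ₗ brtOf k A φ e ∘ₗ (SMap k A).toLinearMap = brtOf k A ψ (φ e) := by
  refine TensorProduct.ext' fun a b => ?_
  have hS : (SMap k A).toLinearMap (a ⊗ₜ b) = b ⊗ₜ[k] a := rfl
  obtain ⟨x, hx, hxa⟩ := hb.surjOn (mul_mem_idealOf a (φ e))
  have hxe := mul_eq_self_of_mem_idealOf he hx
  have hbx : b * x ∈ idealOf e := ⟨b * x, by simp only [mul_assoc, hxe]⟩
  have hmul : φ (b * e) * a = φ (b * x) := by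
    rw [hφ, hφ, hxa]
    ring
  have hi := hinv _ hbx
  rw [brtOf_tMap, mul_eq_self_of_mem_idealOf he hbx] at hi
  rw [LinearMap.comp_apply, LinearMap.comp_apply, hS, brtOf_tmul, brtOf_tmul, hmul, hi, ← hxa,
    hψφ x hx, mul_comm]

theorem IsBrt.exists_eq_brtOf {β : A ⊗[k] A →ₗ[k] A} (hβ : IsBrt k A β) :
    ∃ (φ : A →ₗ[k] A) (e : A), Mult φ ∧ e * e = e ∧
      Set.BijOn φ (idealOf e) (idealOf (φ e)) ∧ β = brtOf k A φ e := by
  obtain ⟨hmul, hs, e, hte, hb⟩ := hβ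
  have ht : Mult (β ∘ₗ (tMap k A).toLinearMap) := fun x y => by simp [hmul]
  have hφe : (β ∘ₗ (tMap k A).toLinearMap) e = β 1 := hte
  refine ⟨β ∘ₗ (tMap k A).toLinearMap, e, ht, ?_, by rw [hφe]; exact hb, ?_⟩
  · refine hb.injOn (mul_mem_idealOf e e) (self_mem_idealOf e) ?_
    rw [map_mul, hmul, hte, ← hmul, one_mul]
  · refine TensorProduct.ext' fun a b => ?_
    have hab : a ⊗ₜ[k] b = tMap k A a * sMap k A b := by simp [tMap, sMap]
    rw [brtOf_tmul, ht, hφe, hab, hmul, hs, LinearMap.comp_apply, AlgHom.toLinearMap_apply]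
    ring

theorem eq_and_eqOn_of_brtOf_eq {φ ψ : A →ₗ[k] A} {e f : A} (he : e * e = e)
    (hφ : Set.InjOn φ (idealOf e)) (hf : f * f = f) (hψ : Set.InjOn ψ (idealOf f))
    (h : brtOf k A φ e = brtOf k A ψ f) : e = f ∧ Set.EqOn φ ψ (idealOf e) := by
  have key (a : A) : φ (a * e) = ψ (a * f) := by rw [← brtOf_tMap, h, brtOf_tMap]
  have h₁ : φ e = ψ f := by simpa using key 1
  have hfe : f * e = e := hφ (mul_mem_idealOf f e) (self_mem_idealOf e) (by rw [key, hf, h₁])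
  have hef : e * f = f := hψ (mul_mem_idealOf e f) (self_mem_idealOf f) (by rw [← key, he, h₁])
  obtain rfl : e = f := by rw [← hfe, mul_comm, hef]
  refine ⟨rfl, ?_⟩
  rintro _ ⟨a, rfl⟩
  exact key a

variable (k A)

/-- **`(M(A) ⋉ E(A))ᵒᵖ ≅ Brt(A ⊗ A, A)` as regular monoids**, via
`[φ,e] ↦ α_{[φ,e]}`, `α_{[φ,e]}(a⊗b) = φ(ae)·b`: each `α_{[φ,e]}` is a local
biretraction with (BRT2)-witness `e`; the map reverses products
(`α_{[φ,e]} ∗ α_{[ψ,f]} = α_{[ψ,f]·[φ,e]}`); it sends the identity class to the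
counit `ε`; it sends pseudo-inverses to pseudo-inverses
(`α_{[φ,e]}* = (α∘t)⁻¹∘α∘S = α_{[φ⁻¹, φ(e)]}`); and it is bijective onto
`Brt(A⊗A, A)` up to the defining equivalence of classes. -/
theorem MA_semidirect_EA_iso_Brt :
    -- α_{[φ,e]} is a local biretraction with witness e
    (∀ (φ : A →ₗ[k] A) (e : A), Mult ⇑φ → e * e = e →
      Set.BijOn ⇑φ (idealOf e) (idealOf (φ e)) →
      IsBrt k A (brtOf k A φ e) ∧
      brtOf k A φ e (tMap k A e) = brtOf k A φ e 1 ∧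
      Set.BijOn (fun a => brtOf k A φ e (tMap k A a)) (idealOf e)
        (idealOf (brtOf k A φ e 1))) ∧
    -- the map reverses products: α_{[φ,e]} ∗ α_{[ψ,f]} = α_{[ψ∘φ, φ⁻¹(f·φ(e))]}
    (∀ (φ ψ : A →ₗ[k] A) (e f : A), Mult ⇑φ → e * e = e →
      Set.BijOn ⇑φ (idealOf e) (idealOf (φ e)) →
      Mult ⇑ψ → f * f = f → Set.BijOn ⇑ψ (idealOf f) (idealOf (ψ f)) →
      ∀ g : A, g ∈ idealOf e → φ g = f * φ e →
        conv k A (brtOf k A φ e) (brtOf k A ψ f) = brtOf k A (ψ ∘ₗ φ) g) ∧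
    -- the identity class maps to the counit
    (brtOf k A LinearMap.id 1 = (εMap k A).toLinearMap) ∧
    -- pseudo-inverses map to pseudo-inverses: α_{[φ,e]}* = α_{[φ⁻¹, φ(e)]}
    (∀ (φ ψ : A →ₗ[k] A) (e : A), Mult ⇑φ → e * e = e →
      Set.BijOn ⇑φ (idealOf e) (idealOf (φ e)) →
      Mult ⇑ψ → (∀ x ∈ idealOf e, ψ (φ x) = x) → (∀ y ∈ idealOf (φ e), φ (ψ y) = y) →
      ∀ inv : A →ₗ[k] A,
        (∀ x ∈ idealOf e, inv (brtOf k A φ e (tMap k A x)) = x) →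
        (∀ y ∈ idealOf (brtOf k A φ e 1), brtOf k A φ e (tMap k A (inv y)) = y) →
        inv ∘ₗ (brtOf k A φ e) ∘ₗ (SMap k A).toLinearMap = brtOf k A ψ (φ e)) ∧
    -- surjectivity
    (∀ β : A ⊗[k] A →ₗ[k] A, IsBrt k A β →
      ∃ (φ : A →ₗ[k] A) (e : A), Mult ⇑φ ∧ e * e = e ∧
        Set.BijOn ⇑φ (idealOf e) (idealOf (φ e)) ∧ β = brtOf k A φ e) ∧
    -- injectivity up to the equivalence of classes
    (∀ (φ ψ : A →ₗ[k] A) (e f : A), Mult ⇑φ → e * e = e →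
      Set.BijOn ⇑φ (idealOf e) (idealOf (φ e)) →
      Mult ⇑ψ → f * f = f → Set.BijOn ⇑ψ (idealOf f) (idealOf (ψ f)) →
      brtOf k A φ e = brtOf k A ψ f → e = f ∧ Set.EqOn ⇑φ ⇑ψ (idealOf e)) := by
  refine ⟨fun φ e hφ he hb => ⟨isBrt_brtOf hφ he hb, by rw [brtOf_tMap, brtOf_one, he],
      bijOn_brtOf_tMap he hb⟩,
    fun φ ψ e f hφ _ _ _ _ _ g _ hφg => conv_brtOf ψ hφ hφg,
    brtOf_id_one,
    fun φ ψ e hφ he hb hψ hψφ _ inv hinv _ => brtOf_comp_SMap_eq hφ he hb hψφ hinv,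
    fun β hβ => hβ.exists_eq_brtOf,
    fun φ ψ e f _ he hb _ hf hb' h => eq_and_eqOn_of_brtOf_eq he hb.injOn hf hb'.injOn h⟩
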